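/- For every κ > 0 the following relations hold between the global and local critical fields: H̄_{C3}(κ) ≥ H̄^{loc}(κ) and H_{C3}(κ) ≥ H^{loc}(κ). -/

import Mathlib

open MeasureTheory Filter Set Topology

noncomputable section

namespace SC

/-- The plane `ℝ²`. -/
abbrev Plane := ℝ × ℝ

/-- Squared Euclidean norm on the plane. -/
def esq (v : Plane) : ℝ := v.1 ^ 2 + v.2 ^ 2

/-- Euclidean dot product on the plane. -/
def dot2 (v w : Plane) : ℝ := v.1 * w.1 + v.2 * w.2

/-- The reference vector potential `F₀(x) = (-x₂/2, x₁/2)`, with `curl F₀ = 1`. -/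
def F0 : Plane → Plane := fun x => (-x.2 / 2, x.1 / 2)

/-- `u` is of class `Cⁿ` on a neighborhood of the closure of `Ω`. -/
def CNearCl {E : Type*} [NormedAddCommGroup E] [NormedSpace ℝ E]
    (n : ℕ) (Ω : Set Plane) (u : Plane → E) : Prop :=
  ∃ U : Set Plane, IsOpen U ∧ closure Ω ⊆ U ∧ ContDiffOn ℝ n u U

/-- The pointwise squared magnetic gradient `|(-i∇ - B·A)u|²`. -/
def magSq (B : ℝ) (A : Plane → Plane) (u : Plane → ℂ) (x : Plane) : ℝ :=
  ‖(-Complex.I) * fderiv ℝ u x ((1 : ℝ), (0 : ℝ)) - ((B * (A x).1 : ℝ) : ℂ) * u x‖ ^ 2 +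
  ‖(-Complex.I) * fderiv ℝ u x ((0 : ℝ), (1 : ℝ)) - ((B * (A x).2 : ℝ) : ℂ) * u x‖ ^ 2

/-- `curl A = ∂₁A₂ - ∂₂A₁`. -/
def curl2 (A : Plane → Plane) (x : Plane) : ℝ :=
  fderiv ℝ (fun y => (A y).2) x ((1 : ℝ), (0 : ℝ)) -
    fderiv ℝ (fun y => (A y).1) x ((0 : ℝ), (1 : ℝ))

/-- The variational ground state energy `λ₁(B·A)` of the magnetic Neumann Laplacian. -/
def lam1A (Ω : Set Plane) (B : ℝ) (A : Plane → Plane) : ℝ :=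
  sInf { r : ℝ | ∃ u : Plane → ℂ, CNearCl 1 Ω u ∧ (∫ x in Ω, ‖u x‖ ^ 2) ≠ 0 ∧
    r = (∫ x in Ω, magSq B A u x) / (∫ x in Ω, ‖u x‖ ^ 2) }

/-- `λ₁(B) = λ₁(B·F₀)`. -/
def lam1 (Ω : Set Plane) (B : ℝ) : ℝ := lam1A Ω B F0

/-- The Ginzburg–Landau energy functional. -/
def GLenergy (Ω : Set Plane) (κ H : ℝ) (ψ : Plane → ℂ) (A : Plane → Plane) : ℝ :=
  ∫ x in Ω, (magSq (κ * H) A ψ x - κ ^ 2 * ‖ψ x‖ ^ 2 + κ ^ 2 / 2 * ‖ψ x‖ ^ 4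
    + κ ^ 2 * H ^ 2 * (curl2 A x - 1) ^ 2)

/-- Admissible Ginzburg–Landau configurations. -/
def GLadm (Ω : Set Plane) (ψ : Plane → ℂ) (A : Plane → Plane) : Prop :=
  CNearCl 1 Ω ψ ∧ CNearCl 1 Ω A

/-- The normal state is a minimizer at `(κ, H)`. -/
def NormalMin (Ω : Set Plane) (κ H : ℝ) : Prop :=
  ∀ ψ A, GLadm Ω ψ A → 0 ≤ GLenergy Ω κ H ψ A

/-- The normal state is the unique minimizer at `(κ, H)`. -/
def NormalUnique (Ω : Set Plane) (κ H : ℝ) : Prop :=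
  NormalMin Ω κ H ∧
  ∀ ψ A, GLadm Ω ψ A → (∫ x in Ω, ‖ψ x‖ ^ 2) ≠ 0 → 0 < GLenergy Ω κ H ψ A

/-- `(ψ, A)` is a minimizer of the Ginzburg–Landau energy at `(κ, H)`. -/
def IsGLMin (Ω : Set Plane) (κ H : ℝ) (ψ : Plane → ℂ) (A : Plane → Plane) : Prop :=
  GLadm Ω ψ A ∧ ∀ ψ' A', GLadm Ω ψ' A' → GLenergy Ω κ H ψ A ≤ GLenergy Ω κ H ψ' A'

/-- Lower global critical field. -/
def HC3low (Ω : Set Plane) (κ : ℝ) : ℝ := sInf {H : ℝ | 0 < H ∧ NormalMin Ω κ H}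

/-- Upper global critical field. -/
def HC3up (Ω : Set Plane) (κ : ℝ) : ℝ :=
  sInf {H : ℝ | 0 < H ∧ ∀ H', H < H' → NormalUnique Ω κ H'}

/-- Lower local critical field. -/
def HlocLow (Ω : Set Plane) (κ : ℝ) : ℝ :=
  sInf {H : ℝ | 0 < H ∧ κ ^ 2 ≤ lam1 Ω (κ * H)}

/-- Upper local critical field. -/
def HlocUp (Ω : Set Plane) (κ : ℝ) : ℝ :=
  sInf {H : ℝ | 0 < H ∧ ∀ H', H < H' → κ ^ 2 ≤ lam1 Ω (κ * H')}

/-- The inward unit normal `ν(s) = (-γ₂'(s), γ₁'(s))`. -/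
def nuVec (γ : ℝ → Plane) (s : ℝ) : Plane := (-(deriv γ s).2, (deriv γ s).1)

/-- The curvature `k(s) = ⟨γ''(s), ν(s)⟩`. -/
def curvOf (γ : ℝ → Plane) (s : ℝ) : ℝ := dot2 (deriv (deriv γ) s) (nuVec γ s)

/-- The maximal curvature. -/
def kmaxOf (γ : ℝ → Plane) : ℝ := sSup (Set.range (curvOf γ))

/-- A smooth counterclockwise arclength parametrization of the boundary of `Ω`. -/
structure BoundaryParam (Ω : Set Plane) where
  γ : ℝ → Plane
  L : ℝ
  L_pos : 0 < L
  smooth : ContDiff ℝ (⊤ : ℕ∞) γ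
  periodic : Function.Periodic γ L
  unit_speed : ∀ s, esq (deriv γ s) = 1
  injOn : Set.InjOn γ (Set.Ico 0 L)
  range_eq : Set.range γ = frontier Ω
  inward : ∀ s, ∃ ε > 0, ∀ t ∈ Set.Ioo (0 : ℝ) ε, γ s + t • nuVec γ s ∈ Ω

/-- The non-degeneracy assumption: finitely many points of maximal curvature,
all of them non-degenerate maxima. -/
def NonDegen {Ω : Set Plane} (P : BoundaryParam Ω) : Prop :=
  ∃ (N : ℕ) (s : Fin N → ℝ), 0 < N ∧ (∀ j, s j ∈ Set.Ico 0 P.L) ∧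
    (∀ j, curvOf P.γ (s j) = kmaxOf P.γ) ∧
    (∀ t ∈ Set.Ico 0 P.L, (∀ j, t ≠ s j) → curvOf P.γ t < kmaxOf P.γ) ∧
    (∀ j, deriv (deriv (curvOf P.γ)) (s j) < 0)

/-- The ground state energy `μ(ζ)` of the de Gennes half-line model operator. -/
def muGen (ζ : ℝ) : ℝ :=
  sInf { r : ℝ | ∃ φ : ℝ → ℝ, ContDiff ℝ 1 φ ∧ HasCompactSupport φ ∧
    (∃ τ, 0 < τ ∧ φ τ ≠ 0) ∧
    r = (∫ τ in Set.Ioi (0 : ℝ), ((deriv φ τ) ^ 2 + (τ + ζ) ^ 2 * (φ τ) ^ 2)) /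
        (∫ τ in Set.Ioi (0 : ℝ), (φ τ) ^ 2) }

/-- The de Gennes constant `Θ₀`. -/
def Theta0 : ℝ := sInf (Set.range muGen)

/-- Standard facts about the de Gennes constant, taken as hypotheses. -/
structure DeGennes where
  ξ₀ : ℝ
  u₀ : ℝ → ℝ
  theta_lb : 1 / 2 < Theta0
  theta_ub : Theta0 < 1
  ξ₀_mem : ξ₀ ∈ Set.Ioo (-1 : ℝ) 0
  ξ₀_min : muGen ξ₀ = Theta0
  ξ₀_uniq : ∀ ζ, muGen ζ = Theta0 → ζ = ξ₀
  ξ₀_sq : ξ₀ ^ 2 = Theta0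
  u₀_pos : ∀ τ, 0 ≤ τ → 0 < u₀ τ
  u₀_smooth : ContDiffOn ℝ 2 u₀ (Set.Ici 0)
  u₀_sq_int : IntegrableOn (fun τ => (u₀ τ) ^ 2) (Set.Ioi 0)
  u₀_normalized : (∫ τ in Set.Ioi (0 : ℝ), (u₀ τ) ^ 2) = 1
  u₀_neumann : derivWithin u₀ (Set.Ici 0) 0 = 0
  u₀_ode : ∀ τ ∈ Set.Ioi (0 : ℝ),
    -(deriv (deriv u₀) τ) + (τ + ξ₀) ^ 2 * u₀ τ = Theta0 * u₀ τ

/-- The universal constant `C₁ = u₀(0)²/3`. -/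
def DeGennes.C1 (D : DeGennes) : ℝ := (D.u₀ 0) ^ 2 / 3

/-- Condition (★) on a vector field `A` at field strength `B` with constant `C₀`. -/
def StarCond (Ω : Set Plane) (C₀ B : ℝ) (A : Plane → Plane) : Prop :=
  CNearCl 2 Ω A ∧
  (∀ x ∈ closure Ω, ‖A x‖ ≤ C₀) ∧
  (∀ x ∈ closure Ω, ‖fderiv ℝ A x‖ ≤ C₀) ∧
  (∀ x ∈ closure Ω, ‖fderiv ℝ (fderiv ℝ A) x‖ ≤ C₀) ∧
  (∀ x ∈ closure Ω, |curl2 A x - 1| ≤ C₀ * B ^ (-(1 : ℝ) / 4)) ∧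
  (∀ x ∈ closure Ω, ‖fderiv ℝ (curl2 A) x‖ ≤ C₀ * B ^ (-(1 : ℝ) / 4)) ∧
  (∀ x ∈ frontier Ω, curl2 A x = 1)

/-- The open unit disc. -/
def unitDisc : Set Plane := {x : Plane | x.1 ^ 2 + x.2 ^ 2 < 1}

/-- `Δ_B`: distance from `B/2 + ξ₀√B + δ₀` to the nearest integer. -/
def DeltaB (ξ₀ δ₀ B : ℝ) : ℝ :=
  sInf (Set.range (fun m : ℤ => |(m : ℝ) - B / 2 - ξ₀ * Real.sqrt B - δ₀|))

/-- Euclidean distance to the boundary of `Ω`. -/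
def distBdry (Ω : Set Plane) (x : Plane) : ℝ :=
  sInf ((fun y => Real.sqrt (esq (x - y))) '' frontier Ω)

end SC

namespace SC

lemma _root_.HasStrictDerivAt.exists_injOn_Ioo {c : ℝ → ℝ} {c' s₀ : ℝ}
    (h : HasStrictDerivAt c c' s₀) (hc : c' ≠ 0) :
    ∃ η > 0, InjOn c (Ioo (s₀ - η) (s₀ + η)) := by
  have h1 := h.isLittleO.def (half_pos (abs_pos.2 hc))
  obtain ⟨η, hη, hb⟩ := Metric.eventually_nhds_iff_ball.1 h1
  refine ⟨η, hη, fun x hx y hy hxy => ?_⟩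
  have hm : (x, y) ∈ Metric.ball (s₀, s₀) η := by
    rw [← ball_prod_same, Real.ball_eq_Ioo]
    exact ⟨hx, hy⟩
  have h2 := hb _ hm
  simp only [hxy, sub_self, zero_sub, norm_neg, ContinuousLinearMap.toSpanSingleton_apply,
    smul_eq_mul, norm_mul, Real.norm_eq_abs] at h2
  by_contra hne
  have h3 : 0 < |x - y| := abs_pos.2 (sub_ne_zero.2 hne)
  have h4 := abs_pos.2 hc
  nlinarith

namespace BoundaryParam

variable {Ω : Set Plane}

lemma frontier_nonempty (P : BoundaryParam Ω) : (frontier Ω).Nonempty := by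
  rw [← P.range_eq]; exact Set.range_nonempty _

lemma eq_of_abs_sub_le (P : BoundaryParam Ω) {s s₀ : ℝ} (h : P.γ s = P.γ s₀)
    (hs : |s - s₀| ≤ P.L / 2) : s = s₀ := by
  have hred : ∀ t, P.γ (toIcoMod P.L_pos 0 t) = P.γ t := fun t => by
    rw [toIcoMod, zsmul_eq_mul]
    exact P.periodic.sub_int_mul_eq _
  have hmem : ∀ t, toIcoMod P.L_pos 0 t ∈ Ico 0 P.L := fun t => by
    simpa using toIcoMod_mem_Ico P.L_pos 0 t
  have h1 := P.injOn (hmem s) (hmem s₀) (by rw [hred, hred, h])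
  obtain ⟨n, hn⟩ := (toIcoMod_inj P.L_pos).1 h1 |>.symm |> AddCommGroup.modEq_iff_zsmul.1
  have hL := P.L_pos
  rw [zsmul_eq_mul] at hn
  rw [← hn, abs_mul, abs_of_pos hL] at hs
  have h2 : |(n : ℝ)| < 1 := by
    by_contra hc
    push Not at hc
    nlinarith
  have h3 : n = 0 := by
    rw [← Int.cast_abs] at h2
    have : |n| < 1 := by exact_mod_cast h2
    exact Int.abs_lt_one_iff.1 this
  rw [h3, Int.cast_zero, zero_mul] at hn
  linarith

/-- Near a boundary point, one of the two coordinates is injective on the boundary. -/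
lemma exists_coord_injOn (P : BoundaryParam Ω) {x₀ : Plane} (hx₀ : x₀ ∈ frontier Ω) :
    ∃ ρ > 0, InjOn Prod.fst (frontier Ω ∩ Metric.ball x₀ ρ) ∨
      InjOn Prod.snd (frontier Ω ∩ Metric.ball x₀ ρ) := by
  obtain ⟨s₀, rfl⟩ : x₀ ∈ range P.γ := by rwa [P.range_eq]
  have hd : HasStrictDerivAt P.γ (deriv P.γ s₀) s₀ :=
    P.smooth.contDiffAt.hasStrictDerivAt (by simp)
  have key : ∀ l : Plane →L[ℝ] ℝ, l (deriv P.γ s₀) ≠ 0 →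
      ∃ ρ > 0, InjOn l (frontier Ω ∩ Metric.ball (P.γ s₀) ρ) := by
    intro l hl
    have h1 : HasStrictDerivAt (fun s => l (P.γ s)) (l (deriv P.γ s₀)) s₀ :=
      l.hasStrictFDerivAt.comp_hasStrictDerivAt s₀ hd
    obtain ⟨η, hη, hinj⟩ := h1.exists_injOn_Ioo hl
    set C := Icc (s₀ - P.L / 2) (s₀ + P.L / 2) \ Ioo (s₀ - η) (s₀ + η)
    have hC : IsCompact C := isCompact_Icc.diff isOpen_Ioo
    have hC' : IsClosed (P.γ '' C) := (hC.image P.smooth.continuous).isClosed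
    have hnot : P.γ s₀ ∉ P.γ '' C := by
      rintro ⟨s, ⟨hs1, hs2⟩, hs3⟩
      have : s = s₀ := P.eq_of_abs_sub_le hs3 (abs_le.2 ⟨by linarith [hs1.1], by linarith [hs1.2]⟩)
      exact hs2 (by rw [this]; constructor <;> linarith)
    obtain ⟨ρ, hρ, hball⟩ := Metric.isOpen_iff.1 hC'.isOpen_compl _ hnot
    have hrep : ∀ q ∈ frontier Ω ∩ Metric.ball (P.γ s₀) ρ, ∃ s ∈ Ioo (s₀ - η) (s₀ + η),
        P.γ s = q := by
      rintro q ⟨hq1, hq2⟩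
      rw [← P.range_eq, ← P.periodic.image_Icc P.L_pos (s₀ - P.L / 2)] at hq1
      obtain ⟨s, hs, rfl⟩ := hq1
      refine ⟨s, ?_, rfl⟩
      by_contra hne
      refine hball hq2 ⟨s, ⟨⟨hs.1, by linarith [hs.2]⟩, hne⟩, rfl⟩
    refine ⟨ρ, hρ, fun q hq q' hq' hqq => ?_⟩
    obtain ⟨s, hs, rfl⟩ := hrep q hq
    obtain ⟨s', hs', rfl⟩ := hrep q' hq'
    rw [hinj hs hs' hqq]
  by_cases ha : (deriv P.γ s₀).1 = 0
  · have hb : (deriv P.γ s₀).2 ≠ 0 := by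
      intro hb
      have := P.unit_speed s₀
      simp [esq, ha, hb] at this
    obtain ⟨ρ, hρ, h⟩ := key (ContinuousLinearMap.snd ℝ ℝ ℝ) hb
    exact ⟨ρ, hρ, Or.inr h⟩
  · obtain ⟨ρ, hρ, h⟩ := key (ContinuousLinearMap.fst ℝ ℝ ℝ) ha
    exact ⟨ρ, hρ, Or.inl h⟩

end BoundaryParam

lemma segment_mem_of_forall_notMem_frontier {Ω : Set Plane} (ho : IsOpen Ω) {p v : Plane}
    {τ : ℝ} (hτ : 0 ≤ τ) (hp : p ∈ Ω) (h : ∀ t ∈ Icc 0 τ, p + t • v ∉ frontier Ω) :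
    ∀ t ∈ Icc 0 τ, p + t • v ∈ Ω := by
  have hpre : IsPreconnected ((fun t : ℝ => p + t • v) '' Icc 0 τ) :=
    isPreconnected_Icc.image _ (by fun_prop)
  have hdich : ∀ t ∈ Icc 0 τ, p + t • v ∈ Ω ∨ p + t • v ∈ (closure Ω)ᶜ := by
    intro t ht
    by_contra! hc
    exact h t ht (ho.frontier_eq ▸ ⟨not_not.1 hc.2, hc.1⟩)
  intro t ht
  by_contra hc
  obtain ⟨z, -, hz1, hz2⟩ := hpre Ω (closure Ω)ᶜ ho isClosed_closure.isOpen_compl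
    (by rintro _ ⟨s, hs, rfl⟩; exact hdich s hs)
    ⟨p, ⟨0, ⟨le_rfl, hτ⟩, by simp⟩, hp⟩ ⟨_, ⟨t, ht, rfl⟩, (hdich t ht).resolve_left hc⟩
  exact hz2 (subset_closure hz1)

/-- The four coordinate directions. -/
def dirs : Finset Plane := {(1, 0), (-1, 0), (0, 1), (0, -1)}

lemma norm_of_mem_dirs {v : Plane} (hv : v ∈ dirs) : ‖v‖ = 1 := by
  simp only [dirs, Finset.mem_insert, Finset.mem_singleton] at hv
  rcases hv with rfl | rfl | rfl | rfl <;> simp [Prod.norm_def]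

namespace BoundaryParam

variable {Ω : Set Plane}

lemma exists_transversal (P : BoundaryParam Ω) (x : Plane) :
    ∃ ρ > 0, ∃ e : Plane, e ∈ dirs ∧ -e ∈ dirs ∧
      ∀ q ∈ frontier Ω ∩ Metric.ball x ρ, ∀ t : ℝ,
        q + t • e ∈ frontier Ω ∩ Metric.ball x ρ → t = 0 := by
  by_cases hx : x ∈ frontier Ω
  · obtain ⟨ρ, hρ, h | h⟩ := P.exists_coord_injOn hx
    · refine ⟨ρ, hρ, (0, 1), by simp [dirs], by simp [dirs], fun q hq t hqt => ?_⟩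
      simpa using h hq hqt (by simp)
    · refine ⟨ρ, hρ, (1, 0), by simp [dirs], by simp [dirs], fun q hq t hqt => ?_⟩
      simpa using h hq hqt (by simp)
  · obtain ⟨ρ, hρ, h⟩ := Metric.isOpen_iff.1 isClosed_frontier.isOpen_compl x hx
    exact ⟨ρ, hρ, (1, 0), by simp [dirs], by simp [dirs], fun q hq _ _ => (h hq.2 hq.1).elim⟩

/-- Points of `Ω` can be moved inside `Ω`, along a coordinate direction and for one of two
prescribed times, to a fixed positive distance from the boundary. -/
lemma exists_displacement (P : BoundaryParam Ω) (ho : IsOpen Ω) (hb : Bornology.IsBounded Ω) :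
    ∃ η > 0, ∀ τ ∈ Ioo 0 η, ∃ δ > 0, ∀ p ∈ Ω, ∃ v ∈ dirs, ∃ σ ∈ ({τ / 2, τ} : Finset ℝ),
      (∀ t ∈ Icc 0 σ, p + t • v ∈ Ω) ∧ δ ≤ Metric.infDist (p + σ • v) (frontier Ω) := by
  suffices H : ∃ η > 0, ∀ τ ∈ Ioo 0 η, ∃ δ > 0, ∀ p ∈ closure Ω ∩ Ω, ∃ v ∈ dirs,
      ∃ σ ∈ ({τ / 2, τ} : Finset ℝ), (∀ t ∈ Icc 0 σ, p + t • v ∈ Ω) ∧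
        δ ≤ Metric.infDist (p + σ • v) (frontier Ω) by
    rwa [inter_eq_right.2 subset_closure] at H
  refine IsCompact.induction_on (p := fun s => ∃ η > 0, ∀ τ ∈ Ioo 0 η, ∃ δ > 0, ∀ p ∈ s ∩ Ω,
    ∃ v ∈ dirs, ∃ σ ∈ ({τ / 2, τ} : Finset ℝ), (∀ t ∈ Icc 0 σ, p + t • v ∈ Ω) ∧
      δ ≤ Metric.infDist (p + σ • v) (frontier Ω)) hb.isCompact_closure ?_ ?_ ?_ ?_
  · exact ⟨1, one_pos, fun τ _ => ⟨1, one_pos, fun p hp => hp.1.elim⟩⟩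
  · rintro s t hst ⟨η, hη, h⟩
    refine ⟨η, hη, fun τ hτ => ?_⟩
    obtain ⟨δ, hδ, h⟩ := h τ hτ
    exact ⟨δ, hδ, fun p hp => h p ⟨hst hp.1, hp.2⟩⟩
  · rintro s t ⟨η, hη, h⟩ ⟨η', hη', h'⟩
    refine ⟨min η η', lt_min hη hη', fun τ hτ => ?_⟩
    obtain ⟨δ, hδ, h⟩ := h τ ⟨hτ.1, hτ.2.trans_le (min_le_left _ _)⟩
    obtain ⟨δ', hδ', h'⟩ := h' τ ⟨hτ.1, hτ.2.trans_le (min_le_right _ _)⟩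
    refine ⟨min δ δ', lt_min hδ hδ', ?_⟩
    rintro p ⟨hp | hp, hpΩ⟩
    · obtain ⟨v, hv, σ, hσ, h1, h2⟩ := h p ⟨hp, hpΩ⟩
      exact ⟨v, hv, σ, hσ, h1, (min_le_left _ _).trans h2⟩
    · obtain ⟨v, hv, σ, hσ, h1, h2⟩ := h' p ⟨hp, hpΩ⟩
      exact ⟨v, hv, σ, hσ, h1, (min_le_right _ _).trans h2⟩
  intro x _
  obtain ⟨ρ, hρ, e, he, he', hline⟩ := P.exists_transversal x
  refine ⟨Metric.closedBall x (ρ / 4),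
    mem_nhdsWithin_of_mem_nhds (Metric.closedBall_mem_nhds x (by positivity)),
    ρ / 2, by positivity, fun τ hτ => ?_⟩
  have hmem : ∀ p ∈ Metric.closedBall x (ρ / 4), ∀ v ∈ dirs, ∀ t ∈ Icc (-τ) τ,
      p + t • v ∈ Metric.ball x ρ := by
    intro p hp v hv t ht
    rw [Metric.mem_ball]
    have h1 : dist (p + t • v) p ≤ τ := by
      rw [dist_eq_norm, add_sub_cancel_left, norm_smul, norm_of_mem_dirs hv, mul_one]
      exact abs_le.2 ht
    have h2 := Metric.mem_closedBall.1 hp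
    linarith [dist_triangle (p + t • v) p x, hτ.2]
  have hline' : ∀ v, v = e ∨ v = -e → ∀ q ∈ frontier Ω ∩ Metric.ball x ρ, ∀ t : ℝ,
      q + t • v ∈ frontier Ω ∩ Metric.ball x ρ → t = 0 := by
    rintro v (rfl | rfl) q hq t hqt
    · exact hline q hq t hqt
    · exact neg_eq_zero.1 (hline q hq (-t) (by simpa using hqt))
  have hpos : ∀ v ∈ dirs, (v = e ∨ v = -e) → ∃ δ > 0, ∀ p ∈ Metric.closedBall x (ρ / 4),
      δ ≤ max (Metric.infDist (p + (τ / 2) • v) (frontier Ω))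
        (Metric.infDist (p + τ • v) (frontier Ω)) := by
    intro v hv hve
    refine (isCompact_closedBall x (ρ / 4)).exists_forall_le' (a := 0) ?_ fun p hp => ?_
    · refine Continuous.continuousOn ?_
      exact ((Metric.continuous_infDist_pt _).comp (by fun_prop)).max
        ((Metric.continuous_infDist_pt _).comp (by fun_prop))
    · have hd : ∀ q, q ∉ frontier Ω → 0 < Metric.infDist q (frontier Ω) := fun q hq =>
        (isClosed_frontier.notMem_iff_infDist_pos P.frontier_nonempty).1 hq
      by_contra hcon
      rw [not_lt, max_le_iff] at hcon
      have h1 : p + (τ / 2) • v ∈ frontier Ω := by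
        by_contra h
        linarith [hd _ h]
      have h2 : p + τ • v ∈ frontier Ω := by
        by_contra h
        linarith [hd _ h]
      have h3 : p + τ • v = p + (τ / 2) • v + (τ / 2) • v := by
        rw [add_assoc, ← add_smul, add_halves]
      have := hline' v hve _ ⟨h1, hmem p hp v hv _ ⟨by linarith [hτ.1], by linarith [hτ.1]⟩⟩ (τ / 2)
        ⟨h3 ▸ h2, h3 ▸ hmem p hp v hv τ ⟨by linarith [hτ.1], le_rfl⟩⟩
      linarith [hτ.1]
  obtain ⟨δ₁, hδ₁, h₁⟩ := hpos e he (Or.inl rfl)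
  obtain ⟨δ₂, hδ₂, h₂⟩ := hpos (-e) he' (Or.inr rfl)
  refine ⟨min δ₁ δ₂, lt_min hδ₁ hδ₂, ?_⟩
  rintro p ⟨hp, hpΩ⟩
  have hnf : p ∉ frontier Ω := fun h => by
    rw [ho.frontier_eq] at h
    exact h.2 hpΩ
  have finish : ∀ v ∈ dirs, min δ₁ δ₂ ≤ max (Metric.infDist (p + (τ / 2) • v) (frontier Ω))
        (Metric.infDist (p + τ • v) (frontier Ω)) →
      (∀ t ∈ Icc 0 τ, p + t • v ∉ frontier Ω) →
      ∃ v ∈ dirs, ∃ σ ∈ ({τ / 2, τ} : Finset ℝ), (∀ t ∈ Icc 0 σ, p + t • v ∈ Ω) ∧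
        min δ₁ δ₂ ≤ Metric.infDist (p + σ • v) (frontier Ω) := by
    intro v hv hmax hno
    have hseg := segment_mem_of_forall_notMem_frontier ho hτ.1.le hpΩ hno
    rcases le_max_iff.1 hmax with h | h
    · exact ⟨v, hv, τ / 2, by simp, fun t ht => hseg t ⟨ht.1, by linarith [ht.2, hτ.1]⟩, h⟩
    · exact ⟨v, hv, τ, by simp, hseg, h⟩
  by_cases hcase : ∃ t ∈ Icc 0 τ, p + t • e ∈ frontier Ω
  · obtain ⟨t, ht, htf⟩ := hcase
    refine finish (-e) he' ((min_le_right _ _).trans (h₂ p hp)) fun s hs hsf => hnf ?_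
    have h3 : p + t • e = p + s • -e + (s + t) • e := by
      rw [smul_neg, add_smul]; abel
    have h4 := hline _ ⟨hsf, hmem p hp _ he' s ⟨by linarith [hs.1, hτ.1], hs.2⟩⟩ (s + t)
        ⟨h3 ▸ htf, h3 ▸ hmem p hp _ he t ⟨by linarith [ht.1, hτ.1], ht.2⟩⟩
    have h5 : t = 0 := by linarith [hs.1, ht.1]
    simpa [h5] using htf
  · push Not at hcase
    exact finish e he ((min_le_left _ _).trans (h₁ p hp)) hcase

end BoundaryParam

/-- Comparison of the mass of `F` on `W` with that on a set containing a translate of `W`. -/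
lemma lintegral_le_of_translate {Ω W K : Set Plane} (ho : IsOpen Ω) {F G : Plane → ℝ} {v : Plane}
    {σ : ℝ} (hσ : 0 ≤ σ) (hW : MeasurableSet W) (hK : MeasurableSet K)
    (hseg : ∀ p ∈ W, ∀ t ∈ Icc 0 σ, p + t • v ∈ Ω) (hend : ∀ p ∈ W, p + σ • v ∈ K)
    (hF : ContDiffOn ℝ 1 F Ω) (hG : ContinuousOn G Ω) (hFG : ∀ p ∈ Ω, |fderiv ℝ F p v| ≤ G p) :
    ∫⁻ p in W, ENNReal.ofReal (F p) ≤
      (∫⁻ p in K, ENNReal.ofReal (F p)) + ENNReal.ofReal σ * ∫⁻ p in Ω, ENNReal.ofReal (G p) := by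
  classical
  set g : Plane → ENNReal := Ω.indicator fun p => ENNReal.ofReal (G p) with hg
  have hgm : Measurable g := by
    rw [hg, ← piecewise_eq_indicator]
    exact ContinuousOn.measurable_piecewise (ENNReal.continuous_ofReal.comp_continuousOn hG)
      continuousOn_const ho.measurableSet
  have hgm2 : Measurable fun z : Plane × ℝ => g (z.1 + z.2 • v) :=
    hgm.comp (by fun_prop)
  have hpt : ∀ p ∈ W, ENNReal.ofReal (F p) ≤
      K.indicator (fun q => ENNReal.ofReal (F q)) (p + σ • v) +
        ∫⁻ t in Icc 0 σ, g (p + t • v) := by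
    intro p hp
    have hmaps : MapsTo (fun t : ℝ => p + t • v) (Icc 0 σ) Ω := fun t ht => hseg p hp t ht
    have hcl : Continuous fun t : ℝ => p + t • v := by fun_prop
    have hGc : ContinuousOn (fun t : ℝ => G (p + t • v)) (Icc 0 σ) :=
      hG.comp hcl.continuousOn hmaps
    have hF'c : ContinuousOn (fun t : ℝ => fderiv ℝ F (p + t • v) v) (Icc 0 σ) :=
      ((hF.continuousOn_fderiv_of_isOpen ho le_rfl).comp hcl.continuousOn hmaps).clm_apply
        continuousOn_const
    have hGi : IntervalIntegrable (fun t : ℝ => G (p + t • v)) volume 0 σ :=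
      ContinuousOn.intervalIntegrable (by rwa [uIcc_of_le hσ])
    have hF'i : IntervalIntegrable (fun t : ℝ => fderiv ℝ F (p + t • v) v) volume 0 σ :=
      ContinuousOn.intervalIntegrable (by rwa [uIcc_of_le hσ])
    have hftc := intervalIntegral.integral_eq_sub_of_hasDerivAt
      (f := fun t : ℝ => F (p + t • v)) (f' := fun t : ℝ => fderiv ℝ F (p + t • v) v)
      (a := 0) (b := σ) (fun t ht => by
        rw [uIcc_of_le hσ] at ht
        have h1 : HasFDerivAt F (fderiv ℝ F (p + t • v)) (p + t • v) :=
          ((hF.differentiableOn one_ne_zero).differentiableAt (ho.mem_nhds (hmaps ht))).hasFDerivAt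
        have h2 : HasDerivAt (fun t : ℝ => p + t • v) v t := by
          simpa using ((hasDerivAt_id t).smul_const v).const_add p
        exact h1.comp_hasDerivAt t h2) hF'i
    have hneg : -∫ t in (0 : ℝ)..σ, fderiv ℝ F (p + t • v) v ≤ ∫ t in (0 : ℝ)..σ, G (p + t • v) := by
      rw [← intervalIntegral.integral_neg]
      exact intervalIntegral.integral_mono_on hσ hF'i.neg hGi fun t ht =>
        (neg_le_abs _).trans (hFG _ (hmaps ht))
    have hGeq : ENNReal.ofReal (∫ t in (0 : ℝ)..σ, G (p + t • v)) =
        ∫⁻ t in Icc 0 σ, g (p + t • v) := by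
      rw [intervalIntegral.integral_of_le hσ, ← integral_Icc_eq_integral_Ioc,
        ofReal_integral_eq_lintegral_ofReal]
      · refine setLIntegral_congr_fun measurableSet_Icc fun t ht => ?_
        simp [hg, hmaps ht]
      · exact hGc.integrableOn_Icc
      · exact (ae_restrict_mem measurableSet_Icc).mono fun t ht =>
          (abs_nonneg _).trans (hFG _ (hmaps ht))
    rw [indicator_of_mem (hend p hp), ← hGeq]
    refine (ENNReal.ofReal_le_ofReal ?_).trans ENNReal.ofReal_add_le
    simp only [zero_smul, add_zero] at hftc
    linarith
  calc ∫⁻ p in W, ENNReal.ofReal (F p)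
      ≤ ∫⁻ p in W, (K.indicator (fun q => ENNReal.ofReal (F q)) (p + σ • v) +
        ∫⁻ t in Icc 0 σ, g (p + t • v)) := setLIntegral_mono' hW hpt
    _ = (∫⁻ p in W, K.indicator (fun q => ENNReal.ofReal (F q)) (p + σ • v)) +
        ∫⁻ p in W, ∫⁻ t in Icc 0 σ, g (p + t • v) :=
      lintegral_add_right _ hgm2.lintegral_prod_right'
    _ ≤ _ := by
      refine add_le_add ?_ ?_
      · refine (setLIntegral_le_lintegral _ _).trans_eq ?_
        rw [lintegral_add_right_eq_self, lintegral_indicator hK]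
      · rw [lintegral_lintegral_swap hgm2.aemeasurable]
        calc ∫⁻ t in Icc 0 σ, ∫⁻ p in W, g (p + t • v)
            ≤ ∫⁻ t in Icc 0 σ, ∫⁻ p, g p := lintegral_mono fun t => by
              refine (setLIntegral_le_lintegral _ _).trans_eq ?_
              exact lintegral_add_right_eq_self g (t • v)
          _ = _ := by
            rw [setLIntegral_const, Real.volume_Icc, sub_zero, mul_comm, hg,
              lintegral_indicator ho.measurableSet]

lemma integrableOn_of_continuousOn_closure {Ω : Set Plane} (hb : Bornology.IsBounded Ω)
    {f : Plane → ℝ} (hf : ContinuousOn f (closure Ω)) : IntegrableOn f Ω :=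
  (hf.integrableOn_compact hb.isCompact_closure).mono_set subset_closure

/-- On a domain with regular boundary, the mass of `F` is controlled by its mass on a compact
subset, up to a small multiple of the integral of a bound on its gradient. -/
lemma BoundaryParam.exists_isCompact_integral_le {Ω : Set Plane} (P : BoundaryParam Ω)
    (ho : IsOpen Ω) (hb : Bornology.IsBounded Ω) {ε : ℝ} (hε : 0 < ε) :
    ∃ K ⊆ Ω, IsCompact K ∧ ∀ F G : Plane → ℝ, ContDiffOn ℝ 1 F Ω → ContinuousOn F (closure Ω) →
      ContinuousOn G (closure Ω) → (∀ p, 0 ≤ F p) → (∀ p, 0 ≤ G p) →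
      (∀ v ∈ dirs, ∀ p ∈ Ω, |fderiv ℝ F p v| ≤ G p) →
      ∫ p in Ω, F p ≤ 8 * (∫ p in K, F p) + ε * ∫ p in Ω, G p := by
  obtain ⟨η, hη, H⟩ := P.exists_displacement ho hb
  obtain ⟨τ, hτ0, hτ⟩ := exists_between (lt_min hη (show 0 < ε / 8 by positivity))
  obtain ⟨δ, hδ, H⟩ := H τ ⟨hτ0, hτ.trans_le (min_le_left _ _)⟩
  have hτε : 8 * τ ≤ ε := by linarith [hτ.le.trans (min_le_right _ _)]
  set K := closure Ω ∩ {q | δ ≤ Metric.infDist q (frontier Ω)} with hKdef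
  have hKc : IsCompact K := hb.isCompact_closure.inter_right
    (isClosed_le continuous_const (Metric.continuous_infDist_pt _))
  have hKΩ : K ⊆ Ω := by
    rintro q ⟨hq1, hq2⟩
    by_contra hq
    have : q ∈ frontier Ω := ho.frontier_eq ▸ ⟨hq1, hq⟩
    rw [mem_ofPred_eq, Metric.infDist_zero_of_mem this] at hq2
    linarith
  refine ⟨K, hKΩ, hKc, fun F G hF hFc hGc hF0 hG0 hFG => ?_⟩
  set J : Finset (Plane × ℝ) := dirs ×ˢ ({τ / 2, τ} : Finset ℝ) with hJ
  have hJσ : ∀ j ∈ J, 0 ≤ j.2 ∧ j.2 ≤ τ := by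
    rintro ⟨v, σ⟩ hj
    simp only [hJ, Finset.mem_product, Finset.mem_insert, Finset.mem_singleton] at hj
    rcases hj.2 with h | h <;> constructor <;> simp only [h] <;> linarith
  have hJcard : J.card ≤ 8 := by
    rw [hJ, Finset.card_product]
    exact Nat.mul_le_mul Finset.card_le_four Finset.card_le_two
  let W : Plane × ℝ → Set Plane := fun j =>
    {p | ∀ t ∈ Icc 0 j.2, p + t • j.1 ∈ Ω} ∩ (fun p => p + j.2 • j.1) ⁻¹' K
  have hWm : ∀ j, MeasurableSet (W j) := fun j => by
    refine (IsOpen.measurableSet ?_).inter (hKc.isClosed.preimage (by fun_prop)).measurableSet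
    refine isOpen_iff_mem_nhds.2 fun p hp => ?_
    refine isCompact_Icc.eventually_forall_of_forall_eventually
      (P := fun p t => p + t • j.1 ∈ Ω) fun t ht => ?_
    exact (show Continuous fun z : Plane × ℝ => z.1 + z.2 • j.1 by fun_prop).continuousAt.eventually
      (ho.mem_nhds (hp t ht))
  have hcov : Ω ⊆ ⋃ j : J, W j := by
    intro p hp
    obtain ⟨v, hv, σ, hσ, h1, h2⟩ := H p hp
    have hj : (v, σ) ∈ J := Finset.mem_product.2 ⟨hv, hσ⟩
    have hσ0 := (hJσ _ hj).1
    exact mem_iUnion.2 ⟨⟨_, hj⟩, h1, subset_closure (h1 σ ⟨hσ0, le_rfl⟩), h2⟩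
  have hFi := integrableOn_of_continuousOn_closure hb hFc
  have hGi := integrableOn_of_continuousOn_closure hb hGc
  have hFK : 0 ≤ ∫ p in K, F p := integral_nonneg hF0
  have hGΩ : 0 ≤ ∫ p in Ω, G p := integral_nonneg hG0
  have e1 := ofReal_integral_eq_lintegral_ofReal hFi (Eventually.of_forall hF0)
  have e2 := ofReal_integral_eq_lintegral_ofReal (hFi.mono_set hKΩ) (Eventually.of_forall hF0)
  have e3 := ofReal_integral_eq_lintegral_ofReal hGi (Eventually.of_forall hG0)
  have hpiece : ∀ j ∈ J, ∫⁻ p in W j, ENNReal.ofReal (F p) ≤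
      ENNReal.ofReal ((∫ p in K, F p) + τ * ∫ p in Ω, G p) := by
    intro j hj
    refine (lintegral_le_of_translate ho (hJσ j hj).1 (hWm j) hKc.measurableSet
      (fun p hp => hp.1) (fun p hp => hp.2) hF (hGc.mono subset_closure)
      (hFG _ (Finset.mem_product.1 hj).1)).trans ?_
    rw [← e2, ← e3, ← ENNReal.ofReal_mul (hJσ j hj).1,
      ← ENNReal.ofReal_add hFK (mul_nonneg (hJσ j hj).1 hGΩ)]
    gcongr
    exact (hJσ j hj).2
  have hmain : ENNReal.ofReal (∫ p in Ω, F p) ≤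
      ENNReal.ofReal (8 * ((∫ p in K, F p) + τ * ∫ p in Ω, G p)) := by
    calc ENNReal.ofReal (∫ p in Ω, F p) = ∫⁻ p in Ω, ENNReal.ofReal (F p) := e1
      _ ≤ ∫⁻ p in ⋃ j : J, W j, ENNReal.ofReal (F p) := lintegral_mono_set hcov
      _ ≤ ∑' j : J, ∫⁻ p in W j, ENNReal.ofReal (F p) := lintegral_iUnion_le _ _
      _ = ∑ j ∈ J, ∫⁻ p in W j, ENNReal.ofReal (F p) := by
        rw [tsum_fintype, Finset.sum_coe_sort J fun j => ∫⁻ p in W j, ENNReal.ofReal (F p)]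
      _ ≤ J.card • ENNReal.ofReal ((∫ p in K, F p) + τ * ∫ p in Ω, G p) :=
        Finset.sum_le_card_nsmul _ _ _ hpiece
      _ ≤ _ := by
        rw [ENNReal.ofReal_mul (by norm_num), nsmul_eq_mul]
        gcongr
        exact_mod_cast hJcard
  rw [ENNReal.ofReal_le_ofReal_iff (by positivity)] at hmain
  nlinarith

section CompactSupport

variable {f g u w : Plane → ℝ}

lemma continuous_fderiv_apply_const (hf : ContDiff ℝ 1 f) (v : Plane) :
    Continuous fun x => fderiv ℝ f x v :=
  (hf.continuous_fderiv one_ne_zero).clm_apply continuous_const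

lemma hasCompactSupport_fderiv_apply_const (hf : HasCompactSupport f) (v : Plane) :
    HasCompactSupport fun x => fderiv ℝ f x v :=
  (hf.fderiv ℝ).comp_left (g := fun l : Plane →L[ℝ] ℝ => l v) (by simp)

lemma integral_fderiv_apply_eq_zero (hf : ContDiff ℝ 1 f) (hfc : HasCompactSupport f)
    (v : Plane) : ∫ x, fderiv ℝ f x v = 0 := by
  have h := integral_mul_fderiv_eq_neg_fderiv_mul_of_integrable (μ := (volume : Measure Plane))
    (f := fun _ : Plane => (1 : ℝ)) (g := f) (v := v) (by simp)
    (by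
      simpa using (continuous_fderiv_apply_const hf v).integrable_of_hasCompactSupport
        (hasCompactSupport_fderiv_apply_const hfc v))
    (by simpa using hf.continuous.integrable_of_hasCompactSupport hfc)
    (fun x _ => by fun_prop) (fun x _ => hf.differentiable one_ne_zero x)
  simpa using h

lemma hasDerivAt_integral_translate (hf : ContDiff ℝ 1 f) (hfc : HasCompactSupport f)
    (hg : Continuous g) (hgc : HasCompactSupport g) (b : Plane) :
    HasDerivAt (fun h : ℝ => ∫ x, f (x + h • b) * g x) (∫ x, fderiv ℝ f x b * g x) 0 := by
  have hf' := continuous_fderiv_apply_const hf b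
  obtain ⟨C, hC⟩ := hf'.bounded_above_of_compact_support
    (hasCompactSupport_fderiv_apply_const hfc b)
  have hmul : ∀ h : ℝ, Continuous fun x => f (x + h • b) * g x := fun h =>
    (hf.continuous.comp (by fun_prop)).mul hg
  have key := hasDerivAt_integral_of_dominated_loc_of_deriv_le (μ := (volume : Measure Plane))
    (F := fun h x => f (x + h • b) * g x) (F' := fun h x => fderiv ℝ f (x + h • b) b * g x)
    (x₀ := (0 : ℝ)) (s := univ) (bound := fun x => C * ‖g x‖) univ_mem
    (Eventually.of_forall fun h => (hmul h).aestronglyMeasurable)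
    ((hmul 0).integrable_of_hasCompactSupport hgc.mul_left)
    (((hf'.comp (by fun_prop)).mul hg).aestronglyMeasurable)
    (Eventually.of_forall fun x h _ => by
      rw [norm_mul]
      exact mul_le_mul_of_nonneg_right (hC _) (norm_nonneg _))
    ((hg.norm.integrable_of_hasCompactSupport hgc.norm).const_mul C)
    (Eventually.of_forall fun x h _ => by
      have h2 : HasDerivAt (fun t : ℝ => x + t • b) b h := by
        simpa using ((hasDerivAt_id h).smul_const b).const_add x
      exact ((hf.differentiable one_ne_zero _).hasFDerivAt.comp_hasDerivAt h h2).mul_const _)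
  simpa using key.2

/-- The Jacobian determinant of a compactly supported `C¹` map integrates to zero. -/
lemma integral_fderiv_mul_fderiv_comm (hu : ContDiff ℝ 1 u) (huc : HasCompactSupport u)
    (hw : ContDiff ℝ 1 w) (hwc : HasCompactSupport w) (a b : Plane) :
    ∫ x, fderiv ℝ u x a * fderiv ℝ w x b = ∫ x, fderiv ℝ u x b * fderiv ℝ w x a := by
  have hua := continuous_fderiv_apply_const hu a
  have hwa := continuous_fderiv_apply_const hw a
  have huac := hasCompactSupport_fderiv_apply_const huc a
  have hwac := hasCompactSupport_fderiv_apply_const hwc a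
  have h1 := hasDerivAt_integral_translate hw hwc hua huac b
  have h2 := (hasDerivAt_integral_translate hu huc hwa hwac (-b)).neg
  have heq : ∀ h : ℝ, ∫ x, w (x + h • b) * fderiv ℝ u x a =
      -∫ x, u (x + h • -b) * fderiv ℝ w x a := by
    intro h
    have hwh : ContDiff ℝ 1 fun x => w (x + h • b) := hw.comp (by fun_prop)
    have hfd : ∀ x, fderiv ℝ (fun x => w (x + h • b)) x = fderiv ℝ w (x + h • b) := fun x =>
      fderiv_comp_add_right _
    have ibp := integral_mul_fderiv_eq_neg_fderiv_mul_of_integrable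
      (μ := (volume : Measure Plane)) (f := fun x => w (x + h • b)) (g := u) (v := a)
      (((continuous_fderiv_apply_const hwh a).mul hu.continuous).integrable_of_hasCompactSupport
        huc.mul_left)
      ((hwh.continuous.mul hua).integrable_of_hasCompactSupport huac.mul_left)
      ((hwh.continuous.mul hu.continuous).integrable_of_hasCompactSupport huc.mul_left)
      (fun x _ => hwh.differentiable one_ne_zero x) (fun x _ => hu.differentiable one_ne_zero x)
    rw [ibp, ← integral_add_right_eq_self (fun x => u (x + h • -b) * fderiv ℝ w x a) (h • b)]
    congr 1
    refine integral_congr_ae (Eventually.of_forall fun x => ?_)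
    simp [hfd, mul_comm]
  rw [funext heq] at h1
  have h3 := h1.unique h2
  simp only [map_neg, neg_mul, integral_neg, neg_neg] at h3
  rw [← h3]
  exact integral_congr_ae (Eventually.of_forall fun x => mul_comm _ _)

end CompactSupport

variable {Ω : Set Plane}

lemma contDiff_smul_of_tsupport_subset {E : Type*} [NormedAddCommGroup E] [NormedSpace ℝ E]
    (ho : IsOpen Ω) {χ : Plane → ℝ} (hχ : ContDiff ℝ 1 χ) (hs : tsupport χ ⊆ Ω) {f : Plane → E}
    (hf : ContDiffOn ℝ 1 f Ω) : ContDiff ℝ 1 fun x => χ x • f x :=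
  contDiff_iff_contDiffAt.2 fun x => by
    by_cases hx : x ∈ tsupport χ
    · exact hχ.contDiffAt.smul (hf.contDiffAt (ho.mem_nhds (hs hx)))
    · refine (contDiffAt_const (c := (0 : E))).congr_of_eventuallyEq ?_
      filter_upwards [notMem_tsupport_iff_eventuallyEq.1 hx] with y hy
      simp [hy]

lemma setIntegral_fderiv_mul_eq_integral {f g : Plane → ℝ} (hs : tsupport f ⊆ Ω) (v : Plane) :
    ∫ x in Ω, fderiv ℝ f x v * g x = ∫ x, fderiv ℝ f x v * g x := by
  refine setIntegral_eq_integral_of_forall_compl_eq_zero fun x hx => ?_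
  rw [fderiv_of_notMem_tsupport ℝ fun h => hx (hs h)]
  simp

lemma magSq_eq (B : ℝ) (A : Plane → Plane) (ψ : Plane → ℂ) (x : Plane) :
    magSq B A ψ x =
      (((fderiv ℝ ψ x (1, 0)).im - B * (A x).1 * (ψ x).re) ^ 2 +
        ((fderiv ℝ ψ x (1, 0)).re + B * (A x).1 * (ψ x).im) ^ 2) +
      (((fderiv ℝ ψ x (0, 1)).im - B * (A x).2 * (ψ x).re) ^ 2 +
        ((fderiv ℝ ψ x (0, 1)).re + B * (A x).2 * (ψ x).im) ^ 2) := by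
  simp only [magSq, Complex.sq_norm, Complex.normSq_apply, Complex.sub_re, Complex.mul_re,
    Complex.neg_re, Complex.neg_im, Complex.I_re, Complex.I_im, Complex.sub_im, Complex.mul_im,
    Complex.ofReal_re, Complex.ofReal_im]
  ring

lemma sq_norm_eq (z : ℂ) : ‖z‖ ^ 2 = z.re ^ 2 + z.im ^ 2 := by
  rw [Complex.sq_norm, Complex.normSq_apply]; ring

lemma magnetic_cutoff_inequality {χ χ₁ χ₂ p q p₁ q₁ p₂ q₂ a₁ a₂ B C : ℝ} (hχ : χ ^ 2 ≤ 1)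
    (hC : χ₁ ^ 2 + χ₂ ^ 2 ≤ C) :
    2 * ((χ * p₁ + χ₁ * p) * (χ * q₂ + χ₂ * q) - (χ * p₂ + χ₂ * p) * (χ * q₁ + χ₁ * q)) -
      B * a₂ * (2 * (χ * p * (χ * p₁ + χ₁ * p) + χ * q * (χ * q₁ + χ₁ * q))) +
      B * a₁ * (2 * (χ * p * (χ * p₂ + χ₂ * p) + χ * q * (χ * q₂ + χ₂ * q))) ≤
    2 * (((q₁ - B * a₁ * p) ^ 2 + (p₁ + B * a₁ * q) ^ 2) +
      ((q₂ - B * a₂ * p) ^ 2 + (p₂ + B * a₂ * q) ^ 2)) + 2 * C * (p ^ 2 + q ^ 2) := by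
  set M := ((q₁ - B * a₁ * p) ^ 2 + (p₁ + B * a₁ * q) ^ 2) +
      ((q₂ - B * a₂ * p) ^ 2 + (p₂ + B * a₂ * q) ^ 2) with hM
  have h1 : χ ^ 2 * M ≤ M := mul_le_of_le_one_left (by positivity) hχ
  have h2 : (χ₁ ^ 2 + χ₂ ^ 2) * (p ^ 2 + q ^ 2) ≤ C * (p ^ 2 + q ^ 2) := by gcongr
  have hx : ∀ s t : ℝ, (s + t) ^ 2 ≤ 2 * s ^ 2 + 2 * t ^ 2 := fun s t => by
    linarith [sq_nonneg (s - t)]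
  have h3 := hx (χ * (q₁ - B * a₁ * p)) (χ₁ * q)
  have h4 := hx (χ * (p₁ + B * a₁ * q)) (χ₁ * p)
  have h5 := hx (χ * (q₂ - B * a₂ * p)) (χ₂ * q)
  have h6 := hx (χ * (p₂ + B * a₂ * q)) (χ₂ * p)
  have h7 := sq_nonneg ((χ * (q₁ - B * a₁ * p) + χ₁ * q) + (χ * (p₂ + B * a₂ * q) + χ₂ * p))
  have h8 := sq_nonneg ((χ * (p₁ + B * a₁ * q) + χ₁ * p) - (χ * (q₂ - B * a₂ * p) + χ₂ * q))
  rw [hM] at h1 ⊢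
  linarith

/-- The magnetic energy controls the field, away from the boundary. -/
lemma integral_curl_le (ho : IsOpen Ω) {B C : ℝ} {A : Plane → Plane} {ψ : Plane → ℂ}
    {χ : Plane → ℝ} (hψ : ContDiffOn ℝ 1 ψ Ω) (hA : ContDiffOn ℝ 1 A Ω) (hχ : ContDiff ℝ 1 χ)
    (hχc : HasCompactSupport χ) (hχs : tsupport χ ⊆ Ω) (hχ1 : ∀ x, χ x ∈ Icc (0 : ℝ) 1)
    (hC : ∀ x, fderiv ℝ χ x (1, 0) ^ 2 + fderiv ℝ χ x (0, 1) ^ 2 ≤ C)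
    (hmi : IntegrableOn (magSq B A ψ) Ω) (hψi : IntegrableOn (fun x => ‖ψ x‖ ^ 2) Ω)
    (hci : IntegrableOn (fun x => curl2 A x * (χ x ^ 2 * ‖ψ x‖ ^ 2)) Ω) :
    B * ∫ x in Ω, curl2 A x * (χ x ^ 2 * ‖ψ x‖ ^ 2) ≤
      2 * (∫ x in Ω, magSq B A ψ x) + 2 * C * ∫ x in Ω, ‖ψ x‖ ^ 2 := by
  have hre : ContDiffOn ℝ 1 (fun x => (ψ x).re) Ω :=
    Complex.reCLM.contDiff.comp_contDiffOn hψ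
  have him : ContDiffOn ℝ 1 (fun x => (ψ x).im) Ω :=
    Complex.imCLM.contDiff.comp_contDiffOn hψ
  have hA1 : ContDiffOn ℝ 1 (fun x => (A x).1) Ω := contDiff_fst.comp_contDiffOn hA
  have hA2 : ContDiffOn ℝ 1 (fun x => (A x).2) Ω := contDiff_snd.comp_contDiffOn hA
  set u : Plane → ℝ := fun x => χ x • (ψ x).re with hu
  set w : Plane → ℝ := fun x => χ x • (ψ x).im with hw
  set F : Plane → ℝ := fun x => χ x * (ψ x).re ^ 2 + χ x * (ψ x).im ^ 2 with hF
  set g₁ : Plane → ℝ := fun x => χ x • (F x * (A x).1) with hg₁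
  set g₂ : Plane → ℝ := fun x => χ x • (F x * (A x).2) with hg₂
  have hFd : ContDiffOn ℝ 1 F Ω :=
    (hχ.contDiffOn.mul (hre.pow 2)).add (hχ.contDiffOn.mul (him.pow 2))
  have hud : ContDiff ℝ 1 u := contDiff_smul_of_tsupport_subset ho hχ hχs hre
  have hwd : ContDiff ℝ 1 w := contDiff_smul_of_tsupport_subset ho hχ hχs him
  have hg₁d : ContDiff ℝ 1 g₁ := contDiff_smul_of_tsupport_subset ho hχ hχs (hFd.mul hA1)
  have hg₂d : ContDiff ℝ 1 g₂ := contDiff_smul_of_tsupport_subset ho hχ hχs (hFd.mul hA2)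
  have hus : tsupport u ⊆ Ω := (tsupport_smul_subset_left _ _).trans hχs
  have huc : HasCompactSupport u := hχc.smul_right
  have hwc : HasCompactSupport w := hχc.smul_right
  have hg₁s : tsupport g₁ ⊆ Ω := (tsupport_smul_subset_left _ _).trans hχs
  have hg₁c : HasCompactSupport g₁ := hχc.smul_right
  have hg₂s : tsupport g₂ ⊆ Ω := (tsupport_smul_subset_left _ _).trans hχs
  have hg₂c : HasCompactSupport g₂ := hχc.smul_right
  have hJi : ∀ a b : Plane, Integrable fun x => fderiv ℝ u x a * fderiv ℝ w x b := fun a b =>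
    ((continuous_fderiv_apply_const hud a).mul
      (continuous_fderiv_apply_const hwd b)).integrable_of_hasCompactSupport
      (hasCompactSupport_fderiv_apply_const huc a).mul_right
  have hgi : ∀ g : Plane → ℝ, ContDiff ℝ 1 g → HasCompactSupport g → ∀ v,
      Integrable fun x => fderiv ℝ g x v := fun g hg hgc v =>
    (continuous_fderiv_apply_const hg v).integrable_of_hasCompactSupport
      (hasCompactSupport_fderiv_apply_const hgc v)
  have hg0 : ∀ g : Plane → ℝ, ContDiff ℝ 1 g → HasCompactSupport g → tsupport g ⊆ Ω → ∀ v,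
      ∫ x in Ω, fderiv ℝ g x v = 0 := fun g hg hgc hgs v => by
    have := setIntegral_fderiv_mul_eq_integral (g := fun _ => 1) hgs v
    simp only [mul_one] at this
    rw [this, integral_fderiv_apply_eq_zero hg hgc]
  have hJ : ∫ x in Ω, fderiv ℝ u x (1, 0) * fderiv ℝ w x (0, 1) =
      ∫ x in Ω, fderiv ℝ u x (0, 1) * fderiv ℝ w x (1, 0) := by
    rw [setIntegral_fderiv_mul_eq_integral hus, setIntegral_fderiv_mul_eq_integral hus]
    exact integral_fderiv_mul_fderiv_comm hud huc hwd hwc _ _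
  have hpt : ∀ x ∈ Ω, B * (curl2 A x * (χ x ^ 2 * ‖ψ x‖ ^ 2)) ≤
      (2 * magSq B A ψ x + 2 * C * ‖ψ x‖ ^ 2) -
        2 * (fderiv ℝ u x (1, 0) * fderiv ℝ w x (0, 1) -
          fderiv ℝ u x (0, 1) * fderiv ℝ w x (1, 0)) +
        B * (fderiv ℝ g₂ x (1, 0) - fderiv ℝ g₁ x (0, 1)) := by
    intro x hx
    have hn := ho.mem_nhds hx
    have dχ := (hχ.differentiable one_ne_zero x).hasFDerivAt
    have dψ := ((hψ.differentiableOn one_ne_zero).differentiableAt hn).hasFDerivAt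
    have dre : HasFDerivAt (fun x => (ψ x).re) (Complex.reCLM.comp (fderiv ℝ ψ x)) x :=
      Complex.reCLM.hasFDerivAt.comp x dψ
    have dim : HasFDerivAt (fun x => (ψ x).im) (Complex.imCLM.comp (fderiv ℝ ψ x)) x :=
      Complex.imCLM.hasFDerivAt.comp x dψ
    have dA1 := ((hA1.differentiableOn one_ne_zero).differentiableAt hn).hasFDerivAt
    have dA2 := ((hA2.differentiableOn one_ne_zero).differentiableAt hn).hasFDerivAt
    have dF := (dχ.mul (dre.pow 2)).add (dχ.mul (dim.pow 2))
    have eu : ∀ v, fderiv ℝ u x v =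
        χ x * (fderiv ℝ ψ x v).re + fderiv ℝ χ x v * (ψ x).re := fun v => by
      rw [(show HasFDerivAt u _ x from dχ.smul dre).fderiv]
      simp
    have ew : ∀ v, fderiv ℝ w x v =
        χ x * (fderiv ℝ ψ x v).im + fderiv ℝ χ x v * (ψ x).im := fun v => by
      rw [(show HasFDerivAt w _ x from dχ.smul dim).fderiv]
      simp
    have eg : ∀ (f : Plane → ℝ) (f' : Plane →L[ℝ] ℝ), HasFDerivAt f f' x → ∀ v,
        fderiv ℝ (fun x => χ x • (F x * f x)) x v =
          2 * (χ x * (ψ x).re * (χ x * (fderiv ℝ ψ x v).re + fderiv ℝ χ x v * (ψ x).re) +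
            χ x * (ψ x).im * (χ x * (fderiv ℝ ψ x v).im + fderiv ℝ χ x v * (ψ x).im)) * f x +
          χ x ^ 2 * ((ψ x).re ^ 2 + (ψ x).im ^ 2) * f' v := by
      intro f f' hf v
      rw [(show HasFDerivAt (fun x => χ x • (F x * f x)) _ x from dχ.smul (dF.mul hf)).fderiv]
      simp [hF]
      ring
    rw [hg₁, hg₂, eg _ _ dA1, eg _ _ dA2, eu, eu, ew, ew, magSq_eq, sq_norm_eq, curl2]
    have h1 := hχ1 x
    have key := magnetic_cutoff_inequality (χ := χ x) (χ₁ := fderiv ℝ χ x (1, 0))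
      (χ₂ := fderiv ℝ χ x (0, 1)) (p := (ψ x).re) (q := (ψ x).im)
      (p₁ := (fderiv ℝ ψ x (1, 0)).re) (q₁ := (fderiv ℝ ψ x (1, 0)).im)
      (p₂ := (fderiv ℝ ψ x (0, 1)).re) (q₂ := (fderiv ℝ ψ x (0, 1)).im)
      (a₁ := (A x).1) (a₂ := (A x).2) (B := B) (C := C) (pow_le_one₀ h1.1 h1.2) (hC x)
    linarith
  have i1 : IntegrableOn (fun x => 2 * magSq B A ψ x + 2 * C * ‖ψ x‖ ^ 2) Ω :=
    (hmi.const_mul 2).add (hψi.const_mul (2 * C))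
  have i2 : IntegrableOn (fun x => 2 * (fderiv ℝ u x (1, 0) * fderiv ℝ w x (0, 1) -
      fderiv ℝ u x (0, 1) * fderiv ℝ w x (1, 0))) Ω :=
    (((hJi _ _).sub (hJi _ _)).const_mul 2).integrableOn
  have i3 : IntegrableOn (fun x => B * (fderiv ℝ g₂ x (1, 0) - fderiv ℝ g₁ x (0, 1))) Ω :=
    (((hgi _ hg₂d hg₂c _).sub (hgi _ hg₁d hg₁c _)).const_mul B).integrableOn
  rw [← integral_const_mul]
  refine (setIntegral_mono_on (hci.const_mul B) ((i1.sub i2).add i3) ho.measurableSet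
    hpt).trans_eq ?_
  have s1 := integral_add (i1.sub i2) i3
  have s2 := integral_sub i1 i2
  have s3 := integral_add (hmi.const_mul 2) (hψi.const_mul (2 * C))
  have s4 := integral_sub (μ := volume.restrict Ω) (hJi (1, 0) (0, 1)).integrableOn (hJi (0, 1) (1, 0)).integrableOn
  have s5 := integral_sub (μ := volume.restrict Ω) (hgi _ hg₂d hg₂c (1, 0)).integrableOn
    (hgi _ hg₁d hg₁c (0, 1)).integrableOn
  simp only [Pi.add_apply, Pi.sub_apply] at s1 s2 s3 s4 s5 ⊢
  rw [s1, s2, s3, integral_const_mul, integral_const_mul, integral_const_mul, integral_const_mul,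
    s4, s5, hJ, hg0 g₁ hg₁d hg₁c hg₁s, hg0 g₂ hg₂d hg₂c hg₂s]
  ring

lemma CNearCl.contDiffOn {E : Type*} [NormedAddCommGroup E] [NormedSpace ℝ E]
    {u : Plane → E} (hu : CNearCl 1 Ω u) : ContDiffOn ℝ 1 u Ω := by
  obtain ⟨U, -, hU, h⟩ := hu
  exact_mod_cast h.mono (subset_closure.trans hU)

lemma CNearCl.continuousOn {E : Type*} [NormedAddCommGroup E] [NormedSpace ℝ E]
    {u : Plane → E} (hu : CNearCl 1 Ω u) : ContinuousOn u (closure Ω) := by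
  obtain ⟨U, -, hU, h⟩ := hu
  exact h.continuousOn.mono hU

lemma CNearCl.continuousOn_fderiv {E : Type*} [NormedAddCommGroup E] [NormedSpace ℝ E]
    {u : Plane → E} (hu : CNearCl 1 Ω u) (v : Plane) :
    ContinuousOn (fun x => fderiv ℝ u x v) (closure Ω) := by
  obtain ⟨U, ho, hU, h⟩ := hu
  have := (h.continuousOn_fderiv_of_isOpen ho (by simp)).mono hU
  exact this.clm_apply continuousOn_const

lemma CNearCl.continuousOn_magSq {B : ℝ} {A : Plane → Plane} {ψ : Plane → ℂ}
    (hψ : CNearCl 1 Ω ψ) (hA : CNearCl 1 Ω A) : ContinuousOn (magSq B A ψ) (closure Ω) := by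
  have h1 := hψ.continuousOn_fderiv (1, 0)
  have h2 := hψ.continuousOn_fderiv (0, 1)
  have h3 := hψ.continuousOn
  have h4 := hA.continuousOn
  unfold magSq
  fun_prop

lemma CNearCl.continuousOn_curl2 {A : Plane → Plane} (hA : CNearCl 1 Ω A) :
    ContinuousOn (curl2 A) (closure Ω) := by
  obtain ⟨U, ho, hU, h⟩ := hA
  have h1 : CNearCl 1 Ω fun x => (A x).1 := ⟨U, ho, hU, contDiff_fst.comp_contDiffOn h⟩
  have h2 : CNearCl 1 Ω fun x => (A x).2 := ⟨U, ho, hU, contDiff_snd.comp_contDiffOn h⟩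
  exact (h2.continuousOn_fderiv _).sub (h1.continuousOn_fderiv _)

lemma magSq_nonneg (B : ℝ) (A : Plane → Plane) (ψ : Plane → ℂ) (x : Plane) :
    0 ≤ magSq B A ψ x := by
  unfold magSq; positivity

lemma GLenergy_eq (hb : Bornology.IsBounded Ω) {κ H : ℝ} {ψ : Plane → ℂ} {A : Plane → Plane}
    (h : GLadm Ω ψ A) :
    GLenergy Ω κ H ψ A = (∫ x in Ω, magSq (κ * H) A ψ x) - κ ^ 2 * (∫ x in Ω, ‖ψ x‖ ^ 2) +
      κ ^ 2 / 2 * (∫ x in Ω, ‖ψ x‖ ^ 4) + κ ^ 2 * H ^ 2 * ∫ x in Ω, (curl2 A x - 1) ^ 2 := by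
  obtain ⟨hψ, hA⟩ := h
  have hc := hψ.continuousOn
  have i1 := integrableOn_of_continuousOn_closure hb (hψ.continuousOn_magSq (B := κ * H) hA)
  have i2 : IntegrableOn (fun x => κ ^ 2 * ‖ψ x‖ ^ 2) Ω :=
    (integrableOn_of_continuousOn_closure hb (hc.norm.pow 2)).const_mul _
  have i3 : IntegrableOn (fun x => κ ^ 2 / 2 * ‖ψ x‖ ^ 4) Ω :=
    (integrableOn_of_continuousOn_closure hb (hc.norm.pow 4)).const_mul _
  have i4 : IntegrableOn (fun x => κ ^ 2 * H ^ 2 * (curl2 A x - 1) ^ 2) Ω :=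
    (integrableOn_of_continuousOn_closure hb
      ((hA.continuousOn_curl2.sub continuousOn_const).pow 2)).const_mul _
  have i12 : IntegrableOn (fun x => magSq (κ * H) A ψ x - κ ^ 2 * ‖ψ x‖ ^ 2) Ω := i1.sub i2
  have i123 : IntegrableOn
    (fun x => magSq (κ * H) A ψ x - κ ^ 2 * ‖ψ x‖ ^ 2 + κ ^ 2 / 2 * ‖ψ x‖ ^ 4) Ω := i12.add i3
  rw [GLenergy, integral_add i123 i4, integral_add i12 i3, integral_sub i1 i2]
  simp only [integral_const_mul]

lemma exists_cutoff (ho : IsOpen Ω) {K : Set Plane} (hK : IsCompact K) (hKΩ : K ⊆ Ω) :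
    ∃ χ : Plane → ℝ, ContDiff ℝ 1 χ ∧ HasCompactSupport χ ∧ tsupport χ ⊆ Ω ∧
      (∀ x, χ x ∈ Icc (0 : ℝ) 1) ∧ ∀ x ∈ K, χ x = 1 := by
  obtain ⟨t, htc, hKt, htΩ⟩ := exists_compact_between hK ho hKΩ
  obtain ⟨f, h1, h0, hf⟩ := exists_contMDiffMap_one_nhds_of_subset_interior (n := 1)
    (modelWithCornersSelf ℝ Plane) hK.isClosed hKt
  have hs : tsupport f ⊆ t := closure_minimal (fun x hx => by
    by_contra h
    exact hx (h0 x h)) htc.isClosed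
  exact ⟨f, f.contMDiff.contDiff, htc.of_isClosed_subset (isClosed_tsupport _) hs,
    hs.trans htΩ, hf, fun x hx => h1.self_of_nhdsSet x hx⟩

lemma abs_fderiv_sq_norm_le {ψ : Plane → ℂ} {x : Plane} (hψ : DifferentiableAt ℝ ψ x) (B : ℝ)
    (A : Plane → Plane) {v : Plane} (hv : v ∈ dirs) :
    |fderiv ℝ (fun y => ‖ψ y‖ ^ 2) x v| ≤ ‖ψ x‖ ^ 2 + magSq B A ψ x := by
  have d := hψ.hasFDerivAt
  have dre : HasFDerivAt (fun y => (ψ y).re) (Complex.reCLM.comp (fderiv ℝ ψ x)) x :=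
    Complex.reCLM.hasFDerivAt.comp x d
  have dim : HasFDerivAt (fun y => (ψ y).im) (Complex.imCLM.comp (fderiv ℝ ψ x)) x :=
    Complex.imCLM.hasFDerivAt.comp x d
  have key : ∀ w, fderiv ℝ (fun y => ‖ψ y‖ ^ 2) x w =
      2 * ((ψ x).re * (fderiv ℝ ψ x w).re + (ψ x).im * (fderiv ℝ ψ x w).im) := fun w => by
    simp only [sq_norm_eq]
    rw [(show HasFDerivAt (fun y => (ψ y).re ^ 2 + (ψ y).im ^ 2) _ x from
      (dre.pow 2).add (dim.pow 2)).fderiv]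
    simp
    ring
  have alg : ∀ p q s t c : ℝ, |2 * (p * s + q * t)| ≤
      p ^ 2 + q ^ 2 + ((t - c * p) ^ 2 + (s + c * q) ^ 2) := fun p q s t c => by
    rw [abs_le]
    constructor
    · linarith [sq_nonneg (p + (s + c * q)), sq_nonneg (q + (t - c * p))]
    · linarith [sq_nonneg (p - (s + c * q)), sq_nonneg (q - (t - c * p))]
  have h1 : |fderiv ℝ (fun y => ‖ψ y‖ ^ 2) x (1, 0)| ≤ ‖ψ x‖ ^ 2 + magSq B A ψ x := by
    rw [key, sq_norm_eq, magSq_eq]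
    refine (alg _ _ _ _ (B * (A x).1)).trans ?_
    exact add_le_add_right (le_add_of_nonneg_right (by positivity)) _
  have h2 : |fderiv ℝ (fun y => ‖ψ y‖ ^ 2) x (0, 1)| ≤ ‖ψ x‖ ^ 2 + magSq B A ψ x := by
    rw [key, sq_norm_eq, magSq_eq]
    refine (alg _ _ _ _ (B * (A x).2)).trans ?_
    exact add_le_add_right (le_add_of_nonneg_left (by positivity)) _
  have n1 : ((-1, 0) : Plane) = -((1, 0) : Plane) := by simp
  have n2 : ((0, -1) : Plane) = -((0, 1) : Plane) := by simp
  simp only [dirs, Finset.mem_insert, Finset.mem_singleton] at hv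
  rcases hv with rfl | rfl | rfl | rfl
  · exact h1
  · rwa [n1, map_neg, abs_neg]
  · exact h2
  · rwa [n2, map_neg, abs_neg]

/-- At strong fields, only configurations with vanishing order parameter have nonpositive energy. -/
lemma exists_forall_integral_sq_eq_zero (ho : IsOpen Ω) (hb : Bornology.IsBounded Ω)
    (P : BoundaryParam Ω) {κ : ℝ} (hκ : 0 < κ) :
    ∃ H₀ : ℝ, 0 < H₀ ∧ ∀ H, H₀ < H → ∀ ψ A, GLadm Ω ψ A → GLenergy Ω κ H ψ A ≤ 0 →
      ∫ x in Ω, ‖ψ x‖ ^ 2 = 0 := by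
  obtain ⟨K, hKΩ, hK, hle⟩ := P.exists_isCompact_integral_le ho hb
    (ε := 1 / (2 * (κ ^ 2 + 1))) (by positivity)
  obtain ⟨χ, hχ, hχc, hχs, hχ1, hχK⟩ := exists_cutoff ho hK hKΩ
  obtain ⟨C, hC⟩ : ∃ C : ℝ, ∀ x, fderiv ℝ χ x (1, 0) ^ 2 + fderiv ℝ χ x (0, 1) ^ 2 ≤ C := by
    have h : ∀ v, ∃ C : ℝ, ∀ x, fderiv ℝ χ x v ^ 2 ≤ C := fun v => by
      obtain ⟨C, hC⟩ := (hasCompactSupport_fderiv_apply_const hχc v).exists_bound_of_continuous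
        (continuous_fderiv_apply_const hχ v)
      exact ⟨C ^ 2, fun x => sq_le_sq' (abs_le.1 (hC x)).1 (abs_le.1 (hC x)).2⟩
    obtain ⟨C₁, h₁⟩ := h (1, 0)
    obtain ⟨C₂, h₂⟩ := h (0, 1)
    exact ⟨C₁ + C₂, fun x => add_le_add (h₁ x) (h₂ x)⟩
  have hC0 : 0 ≤ C := le_trans (by positivity) (hC 0)
  set C' := 2 * κ ^ 2 + 2 * C + (κ ^ 2 + 2) / 2 with hC'
  have hC'0 : 0 < C' := by positivity
  refine ⟨16 * C' / κ, by positivity, fun H hH ψ A hadm hE => ?_⟩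
  have hB : 16 * C' < κ * H := by rwa [div_lt_iff₀' hκ] at hH
  set B := κ * H with hBdef
  have hB0 : 0 < B := by linarith
  rw [GLenergy_eq hb hadm] at hE
  obtain ⟨hψ, hA⟩ := hadm
  have cψ := hψ.continuousOn
  have cm := hψ.continuousOn_magSq (B := B) hA
  have cc := hA.continuousOn_curl2
  have cχ : ContinuousOn χ (closure Ω) := hχ.continuous.continuousOn
  have c2 : ContinuousOn (fun x => ‖ψ x‖ ^ 2) (closure Ω) := cψ.norm.pow 2
  have c4 : ContinuousOn (fun x => ‖ψ x‖ ^ 4) (closure Ω) := cψ.norm.pow 4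
  have cS : ContinuousOn (fun x => (curl2 A x - 1) ^ 2) (closure Ω) :=
    (cc.sub continuousOn_const).pow 2
  have cF : ContinuousOn (fun x => χ x ^ 2 * ‖ψ x‖ ^ 2) (closure Ω) := (cχ.pow 2).mul c2
  have cCF : ContinuousOn (fun x => curl2 A x * (χ x ^ 2 * ‖ψ x‖ ^ 2)) (closure Ω) := cc.mul cF
  have int {f : Plane → ℝ} (hf : ContinuousOn f (closure Ω)) : IntegrableOn f Ω :=
    integrableOn_of_continuousOn_closure hb hf
  set m := ∫ x in Ω, ‖ψ x‖ ^ 2 with hm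
  set M := ∫ x in Ω, magSq B A ψ x with hM
  set Q := ∫ x in Ω, ‖ψ x‖ ^ 4 with hQ
  set S := ∫ x in Ω, (curl2 A x - 1) ^ 2 with hS
  have m0 : 0 ≤ m := integral_nonneg fun x => by positivity
  have M0 : 0 ≤ M := integral_nonneg fun x => magSq_nonneg _ _ _ _
  have Q0 : 0 ≤ Q := integral_nonneg fun x => by positivity
  have S0 : 0 ≤ S := integral_nonneg fun x => sq_nonneg _
  have hE' : M - κ ^ 2 * m + κ ^ 2 / 2 * Q + B ^ 2 * S ≤ 0 := by rwa [hBdef, mul_pow]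
  have q1 : 0 ≤ κ ^ 2 / 2 * Q := by positivity
  have s1 : 0 ≤ B ^ 2 * S := by positivity
  have M1 : M ≤ κ ^ 2 * m := by linarith
  have S1 : B ^ 2 * S ≤ κ ^ 2 * m := by linarith
  have Q1 : Q ≤ 2 * m := le_of_mul_le_mul_left (by linarith) (show 0 < κ ^ 2 / 2 by positivity)
  have hbd : m ≤ 8 * (∫ x in K, ‖ψ x‖ ^ 2) + m / 2 := by
    refine (hle (fun x => ‖ψ x‖ ^ 2) (fun x => ‖ψ x‖ ^ 2 + magSq B A ψ x)
      (hψ.contDiffOn.norm_sq ℝ) c2 (c2.add cm) (fun x => by positivity)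
      (fun x => add_nonneg (by positivity) (magSq_nonneg _ _ _ _)) fun v hv x hx =>
        abs_fderiv_sq_norm_le ((hψ.contDiffOn.differentiableOn one_ne_zero).differentiableAt
          (ho.mem_nhds hx)) _ _ hv).trans ?_
    rw [integral_add (int c2) (int cm), ← hm, ← hM, add_le_add_iff_left]
    calc 1 / (2 * (κ ^ 2 + 1)) * (m + M) ≤ 1 / (2 * (κ ^ 2 + 1)) * (m + κ ^ 2 * m) := by gcongr
      _ = m / 2 := by field_simp; ring
  have hKχ : ∫ x in K, ‖ψ x‖ ^ 2 ≤ ∫ x in Ω, χ x ^ 2 * ‖ψ x‖ ^ 2 := by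
    rw [setIntegral_congr_fun hK.measurableSet
      (g := fun x => χ x ^ 2 * ‖ψ x‖ ^ 2) fun x hx => by simp [hχK x hx]]
    exact setIntegral_mono_set (int cF) (ae_of_all _ fun x => by positivity)
      hKΩ.eventuallyLE
  have hcurl := integral_curl_le ho hψ.contDiffOn hA.contDiffOn hχ hχc hχs hχ1 hC (int cm)
    (int c2) (int cCF)
  have hdiff : B * (∫ x in Ω, χ x ^ 2 * ‖ψ x‖ ^ 2) -
      B * (∫ x in Ω, curl2 A x * (χ x ^ 2 * ‖ψ x‖ ^ 2)) ≤ 1 / 2 * (B ^ 2 * S + Q) := by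
    rw [hS, hQ, ← integral_const_mul (B ^ 2), ← integral_const_mul B, ← integral_const_mul B,
      ← integral_add ((int cS).const_mul _) (int c4), ← integral_const_mul,
      ← integral_sub ((int cF).const_mul B) ((int cCF).const_mul B)]
    refine setIntegral_mono_on (((int cF).const_mul B).sub ((int cCF).const_mul B))
      ((((int cS).const_mul _).add (int c4)).const_mul _) ho.measurableSet fun x _ => ?_
    have h4 : (χ x ^ 2) ^ 2 * ‖ψ x‖ ^ 4 ≤ ‖ψ x‖ ^ 4 :=
      mul_le_of_le_one_left (by positivity)
        (pow_le_one₀ (sq_nonneg _) (pow_le_one₀ (hχ1 x).1 (hχ1 x).2))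
    linarith [sq_nonneg (B * (curl2 A x - 1) + χ x ^ 2 * ‖ψ x‖ ^ 2)]
  have hfin : B * m ≤ 16 * C' * m := by
    have : B * m ≤ 16 * (B * ∫ x in Ω, χ x ^ 2 * ‖ψ x‖ ^ 2) := by
      have : m ≤ 16 * ∫ x in Ω, χ x ^ 2 * ‖ψ x‖ ^ 2 := by linarith
      calc B * m ≤ B * (16 * ∫ x in Ω, χ x ^ 2 * ‖ψ x‖ ^ 2) := by gcongr
        _ = _ := by ring
    rw [hC']
    linarith
  nlinarith

lemma exists_forall_normalUnique (ho : IsOpen Ω) (hb : Bornology.IsBounded Ω)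
    (P : BoundaryParam Ω) {κ : ℝ} (hκ : 0 < κ) :
    ∃ H₀ : ℝ, 0 < H₀ ∧ ∀ H, H₀ < H → NormalUnique Ω κ H := by
  obtain ⟨H₀, h0, h⟩ := exists_forall_integral_sq_eq_zero ho hb P hκ
  refine ⟨H₀, h0, fun H hH => ⟨fun ψ A hadm => ?_, fun ψ A hadm hm => ?_⟩⟩
  · by_contra! hneg
    have hm := h H hH ψ A hadm hneg.le
    rw [GLenergy_eq hb hadm, hm] at hneg
    have h1 : 0 ≤ ∫ x in Ω, magSq (κ * H) A ψ x := integral_nonneg fun x => magSq_nonneg _ _ _ _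
    have h2 : 0 ≤ ∫ x in Ω, ‖ψ x‖ ^ 4 := integral_nonneg fun x => by positivity
    have h3 : 0 ≤ ∫ x in Ω, (curl2 A x - 1) ^ 2 := integral_nonneg fun x => sq_nonneg _
    have : 0 ≤ κ ^ 2 / 2 * (∫ x in Ω, ‖ψ x‖ ^ 4) +
      κ ^ 2 * H ^ 2 * ∫ x in Ω, (curl2 A x - 1) ^ 2 := by positivity
    linarith
  · by_contra! hneg
    exact hm (h H hH ψ A hadm hneg)

lemma curl2_F0 (x : Plane) : curl2 F0 x = 1 := by
  have h1 : HasFDerivAt (fun y : Plane => (F0 y).1) _ x :=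
    (hasFDerivAt_snd (𝕜 := ℝ) (p := x)).neg.mul_const (2⁻¹ : ℝ)
  have h2 : HasFDerivAt (fun y : Plane => (F0 y).2) _ x :=
    (hasFDerivAt_fst (𝕜 := ℝ) (p := x)).mul_const (2⁻¹ : ℝ)
  rw [curl2, h1.fderiv, h2.fderiv]
  norm_num

lemma CNearCl.of_contDiff {E : Type*} [NormedAddCommGroup E] [NormedSpace ℝ E] {n : ℕ}
    {u : Plane → E} (hu : ContDiff ℝ n u) : CNearCl n Ω u :=
  ⟨univ, isOpen_univ, subset_univ _, hu.contDiffOn⟩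

lemma contDiff_F0 {n : WithTop ℕ∞} : ContDiff ℝ n F0 :=
  (contDiff_snd.neg.div_const 2).prodMk (contDiff_fst.div_const 2)

lemma magSq_const_mul {B t : ℝ} {A : Plane → Plane} {u : Plane → ℂ} {x : Plane}
    (hu : DifferentiableAt ℝ u x) :
    magSq B A (fun y => (t : ℂ) * u y) x = t ^ 2 * magSq B A u x := by
  have h : ∀ v, fderiv ℝ (fun y => (t : ℂ) * u y) x v = t * fderiv ℝ u x v := fun v => by
    rw [fderiv_const_mul hu]
    simp
  rw [magSq_eq, magSq_eq, h, h]
  simp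
  ring

lemma NormalMin.le_integral_magSq (ho : IsOpen Ω) (hb : Bornology.IsBounded Ω) {κ H : ℝ}
    (h : NormalMin Ω κ H) {u : Plane → ℂ} (hu : CNearCl 1 Ω u) :
    κ ^ 2 * (∫ x in Ω, ‖u x‖ ^ 2) ≤ ∫ x in Ω, magSq (κ * H) F0 u x := by
  have hF0 : CNearCl 1 Ω F0 := .of_contDiff contDiff_F0
  have key : ∀ t : ℝ, 0 ≤ t ^ 2 * ((∫ x in Ω, magSq (κ * H) F0 u x) -
      κ ^ 2 * ∫ x in Ω, ‖u x‖ ^ 2) + t ^ 4 * (κ ^ 2 / 2 * ∫ x in Ω, ‖u x‖ ^ 4) := fun t => by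
    have hadm : GLadm Ω (fun y => (t : ℂ) * u y) F0 := by
      obtain ⟨U, hU, hs, hd⟩ := hu
      exact ⟨⟨U, hU, hs, contDiffOn_const.mul hd⟩, hF0⟩
    have := h _ _ hadm
    rw [GLenergy_eq hb hadm, setIntegral_congr_fun ho.measurableSet
      (g := fun x => t ^ 2 * magSq (κ * H) F0 u x) fun x hx => magSq_const_mul
        ((hu.contDiffOn.differentiableOn one_ne_zero).differentiableAt (ho.mem_nhds hx))] at this
    simp only [curl2_F0, norm_mul, mul_pow, integral_const_mul, Complex.norm_real,
      Real.norm_eq_abs, sq_abs, Even.pow_abs (show Even 4 by decide), sub_self,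
      integral_zero, ne_eq, OfNat.ofNat_ne_zero, not_false_eq_true, zero_pow, mul_zero,
      add_zero] at this
    linarith
  set a := (∫ x in Ω, magSq (κ * H) F0 u x) - κ ^ 2 * ∫ x in Ω, ‖u x‖ ^ 2 with ha
  set b := κ ^ 2 / 2 * ∫ x in Ω, ‖u x‖ ^ 4 with hb
  rw [← sub_nonneg, ← ha]
  have hlim : Tendsto (fun t : ℝ => a + t ^ 2 * b) (𝓝[≠] 0) (𝓝 a) := by
    have : Continuous fun t : ℝ => a + t ^ 2 * b := by fun_prop
    simpa using (this.tendsto 0).mono_left nhdsWithin_le_nhds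
  refine ge_of_tendsto hlim ?_
  filter_upwards [self_mem_nhdsWithin] with t ht
  have ht2 : 0 < t ^ 2 := by have : t ≠ 0 := ht; positivity
  refine nonneg_of_mul_nonneg_right ?_ ht2
  linarith [key t]

/-- Stability of the normal state in the global sense implies local stability. -/
lemma NormalMin.sq_le_lam1 (ho : IsOpen Ω) (hb : Bornology.IsBounded Ω) (hne : Ω.Nonempty)
    {κ H : ℝ} (h : NormalMin Ω κ H) : κ ^ 2 ≤ lam1 Ω (κ * H) := by
  refine le_csInf ⟨_, fun _ => 1, .of_contDiff contDiff_const, ?_, rfl⟩ ?_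
  · have hpos := ENNReal.toReal_pos (ho.measure_pos volume hne).ne' hb.measure_lt_top.ne
    simpa [Measure.real] using hpos.ne'
  · rintro r ⟨u, hu, hm, rfl⟩
    have hm' : 0 < ∫ x in Ω, ‖u x‖ ^ 2 :=
      (integral_nonneg fun x => by positivity).lt_of_ne hm.symm
    rw [le_div_iff₀ hm']
    exact h.le_integral_magSq ho hb hu

end SC

/-- For every `κ > 0`, the global critical fields dominate the local ones:
`H̄_{C3}(κ) ≥ H̄^{loc}(κ)` and `H_{C3}(κ) ≥ H^{loc}(κ)`. -/
theorem global_ge_local_fields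
    (Ω : Set SC.Plane) (hΩ_open : IsOpen Ω) (hΩ_bdd : Bornology.IsBounded Ω)
    (hΩ_sc : SimplyConnectedSpace ↥Ω) (P : SC.BoundaryParam Ω) :
    ∀ κ : ℝ, 0 < κ →
      SC.HlocUp Ω κ ≤ SC.HC3up Ω κ ∧ SC.HlocLow Ω κ ≤ SC.HC3low Ω κ := by
  intro κ hκ
  have hne : Ω.Nonempty := nonempty_coe_sort.1 inferInstance
  obtain ⟨H₀, h0, h⟩ := SC.exists_forall_normalUnique hΩ_open hΩ_bdd P hκ
  exact ⟨csInf_le_csInf ⟨0, fun H hH => hH.1.le⟩ ⟨H₀, h0, h⟩ fun H hH =>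
      ⟨hH.1, fun H' hH' => (hH.2 H' hH').1.sq_le_lam1 hΩ_open hΩ_bdd hne⟩,
    csInf_le_csInf ⟨0, fun H hH => hH.1.le⟩ ⟨H₀ + 1, by positivity, (h _ (lt_add_one _)).1⟩
      fun H hH => ⟨hH.1, hH.2.sq_le_lam1 hΩ_open hΩ_bdd hne⟩⟩
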